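/- arXiv:2511.23424 — 8 statements merged into one kernel-verified Lean document; each statement's English description precedes it below -/
import Mathlib

section
/- Let γ > 1, k ≥ 0, ρ > 0, r > 0 with r·γ > ρ, let T > 0 and λ ≤ 0. Then sup_{τ ∈ [0,T)} ( −e^{−ρτ} F^{*,k}( λ e^{(ρ−r)τ} ) ) = −F^{*,k}(λ), and the supremum is attained at τ = 0. -/
/-- The concave conjugate `F^{*,k}(p) = inf_{y ≥ 0} (y·p + (1+k)·y^γ)`. -/
noncomputable def Fstar (γ k p : ℝ) : ℝ :=
  sInf ((fun y : ℝ => y * p + (1 + k) * y ^ γ) '' Set.Ici (0 : ℝ))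

/-- The map `τ ↦ −e^{−ρτ}·F^{*,k}(λ·e^{(ρ−r)τ})`. -/
noncomputable def bonusVal (γ k ρ r lam τ : ℝ) : ℝ :=
  -Real.exp (-ρ * τ) * Fstar γ k (lam * Real.exp ((ρ - r) * τ))

theorem bddBelow_mul_add_rpow {γ k p : ℝ} (hγ : 1 < γ) (hk : 0 ≤ k) (hp : p ≤ 0) :
    BddBelow ((fun y : ℝ => y * p + (1 + k) * y ^ γ) '' Set.Ici (0 : ℝ)) := by
  have hM : 0 ≤ (-p) ^ (γ - 1)⁻¹ := Real.rpow_nonneg (by linarith) _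
  refine ⟨(-p) ^ (γ - 1)⁻¹ * p, ?_⟩
  rintro _ ⟨y, hy, rfl⟩
  have hy : 0 ≤ y := hy
  have hyγ : 0 ≤ y ^ γ := Real.rpow_nonneg hy _
  rcases le_total y ((-p) ^ (γ - 1)⁻¹) with h | h
  · have h1 := mul_le_mul_of_nonpos_right h hp
    have h2 : 0 ≤ (1 + k) * y ^ γ := by positivity
    dsimp only
    linarith
  · have h1 : -p ≤ y ^ (γ - 1) := by
      have := Real.rpow_le_rpow hM h (by linarith : 0 ≤ γ - 1)
      rwa [Real.rpow_inv_rpow (by linarith) (by linarith)] at this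
    have h2 : y ^ γ = y * y ^ (γ - 1) := by
      rw [← Real.rpow_one_add' hy (by linarith)]
      ring_nf
    have h3 := mul_le_mul_of_nonneg_left h1 hy
    have h4 := mul_nonpos_of_nonneg_of_nonpos hM hp
    have h5 : 0 ≤ k * y ^ γ := by positivity
    dsimp only
    linarith

theorem Fstar_le {γ k p y : ℝ} (hγ : 1 < γ) (hk : 0 ≤ k) (hp : p ≤ 0) (hy : 0 ≤ y) :
    Fstar γ k p ≤ y * p + (1 + k) * y ^ γ :=
  csInf_le (bddBelow_mul_add_rpow hγ hk hp) ⟨y, hy, rfl⟩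

theorem bonusVal_zero (γ k ρ r lam : ℝ) : bonusVal γ k ρ r lam 0 = -Fstar γ k lam := by
  simp [bonusVal]

theorem bonusVal_le {γ k ρ r lam τ : ℝ} (hγ : 1 < γ) (hk : 0 ≤ k)
    (hreg : ρ ≤ r * γ) (hlam : lam ≤ 0) (hτ : 0 ≤ τ) :
    bonusVal γ k ρ r lam τ ≤ -Fstar γ k lam := by
  have key : Real.exp (ρ * τ) * Fstar γ k lam ≤
      Fstar γ k (lam * Real.exp ((ρ - r) * τ)) := by
    refine le_csInf (Set.nonempty_Ici.image _) ?_
    rintro _ ⟨y, hy, rfl⟩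
    have hy : 0 ≤ y := hy
    have hF := mul_le_mul_of_nonneg_left
      (Fstar_le hγ hk hlam (mul_nonneg hy (Real.exp_pos (-r * τ)).le)) (Real.exp_pos (ρ * τ)).le
    have hpow : (y * Real.exp (-r * τ)) ^ γ = y ^ γ * Real.exp (-r * τ * γ) := by
      rw [Real.mul_rpow hy (Real.exp_pos _).le, ← Real.exp_mul]
    have hlin : Real.exp ((ρ - r) * τ) = Real.exp (ρ * τ) * Real.exp (-r * τ) := by
      rw [← Real.exp_add]
      ring_nf
    have hexp : Real.exp (ρ * τ) * Real.exp (-r * τ * γ) ≤ 1 := by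
      rw [← Real.exp_add, Real.exp_le_one_iff]
      nlinarith
    have hyγ : 0 ≤ (1 + k) * y ^ γ := mul_nonneg (by linarith) (Real.rpow_nonneg hy _)
    have hmul := mul_le_mul_of_nonneg_left hexp hyγ
    rw [hpow] at hF
    dsimp only
    rw [hlin]
    linarith
  have h := mul_le_mul_of_nonneg_left key (Real.exp_pos (-ρ * τ)).le
  rw [← mul_assoc, ← Real.exp_add, neg_mul, neg_add_cancel, Real.exp_zero, one_mul] at h
  rw [bonusVal, neg_mul, neg_mul]
  exact neg_le_neg h

/-- for `γ > 1`, `k ≥ 0`, `ρ, r > 0` with `rγ > ρ`, `T > 0` and `λ ≤ 0`,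
`sup_{τ ∈ [0,T)} (−e^{−ρτ} F^{*,k}(λ e^{(ρ−r)τ})) = −F^{*,k}(λ)`, attained at `τ = 0`. -/
theorem statement3 (γ k ρ r T lam : ℝ) (hγ : 1 < γ) (hk : 0 ≤ k)
    (hρ : 0 < ρ) (hr : 0 < r) (hreg : r * γ > ρ) (hT : 0 < T) (hlam : lam ≤ 0) :
    sSup (bonusVal γ k ρ r lam '' Set.Ico 0 T) = -Fstar γ k lam ∧
    bonusVal γ k ρ r lam 0 = -Fstar γ k lam := by
  refine ⟨IsGreatest.csSup_eq ⟨⟨0, ⟨le_rfl, hT⟩, bonusVal_zero γ k ρ r lam⟩, ?_⟩,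
    bonusVal_zero γ k ρ r lam⟩
  rintro _ ⟨τ, hτ, rfl⟩
  exact bonusVal_le hγ hk hreg.le hlam hτ.1
end

section
/- Let γ > 1, k ≥ 0, ρ > 0, r > 0, T > 0, ā > 0, N ∈ ℕ, and let h : [0, ā] → ℝ be continuous and increasing with h(0) = 0. Define, for λ ≤ 0, FG_N(λ) := −N e^{−ρT} F^{*,k}( λ e^{(ρ−r)T} ) − e^{−ρT} F^{*,0}( λ e^{(ρ−r)T} ) + ∫₀^T ρ e^{−ρt} G^*( (r/ρ)·λ·e^{(ρ−r)t} ) dt. Then FG_N(0) = ā·(1 − e^{−ρT}), and the left derivative of FG_N at 0 exists and equals h(ā)·(1 − e^{−rT}). -/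
/-- The convex dual `G^*(p) = sup_{a ∈ [0, ā]} (a + h(a)·p)`. -/
noncomputable def Gstar (h : ℝ → ℝ) (abar p : ℝ) : ℝ :=
  sSup ((fun a : ℝ => a + h a * p) '' Set.Icc 0 abar)

/-- `FG_N(λ) = −N e^{−ρT} F^{*,k}(λ e^{(ρ−r)T}) − e^{−ρT} F^{*,0}(λ e^{(ρ−r)T})
  + ∫₀^T ρ e^{−ρt} G^*((r/ρ)·λ·e^{(ρ−r)t}) dt`. -/
noncomputable def FGN (γ k ρ r T abar : ℝ) (h : ℝ → ℝ) (N : ℕ) (lam : ℝ) : ℝ :=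
  -(N : ℝ) * Real.exp (-ρ * T) * Fstar γ k (lam * Real.exp ((ρ - r) * T))
    - Real.exp (-ρ * T) * Fstar γ 0 (lam * Real.exp ((ρ - r) * T))
    + ∫ t in (0 : ℝ)..T, ρ * Real.exp (-ρ * t) * Gstar h abar (r / ρ * lam * Real.exp ((ρ - r) * t))

open Set Filter Topology

lemma mem_lowerBounds_image_Fstar {γ k p : ℝ} (hγ : 1 < γ) (hk : 0 ≤ k) (hp : p ≤ 0) :
    p * (-p) ^ (1 / (γ - 1)) ∈
      lowerBounds ((fun y : ℝ => y * p + (1 + k) * y ^ γ) '' Ici (0 : ℝ)) := by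
  rintro _ ⟨y, hy, rfl⟩
  have hy : 0 ≤ y := hy
  have hg : 0 < γ - 1 := sub_pos.2 hγ
  have hq : 0 ≤ -p := neg_nonneg.2 hp
  have hyγ : 0 ≤ y ^ γ := Real.rpow_nonneg hy γ
  have hkγ : 0 ≤ k * y ^ γ := mul_nonneg hk hyγ
  rcases le_total y ((-p) ^ (1 / (γ - 1))) with hle | hle
  · have := mul_le_mul_of_nonneg_right hle hq
    dsimp only
    linarith
  · have hpow : -p ≤ y ^ (γ - 1) := by
      have := Real.rpow_le_rpow (Real.rpow_nonneg hq _) hle hg.le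
      rwa [← Real.rpow_mul hq, one_div_mul_cancel hg.ne', Real.rpow_one] at this
    have hsplit : y ^ γ = y * y ^ (γ - 1) := by
      have := Real.rpow_add_of_nonneg hy zero_le_one hg.le
      rwa [Real.rpow_one, add_sub_cancel] at this
    have h1 := mul_le_mul_of_nonneg_left hpow hy
    have h2 := mul_nonneg hq (Real.rpow_nonneg hq (1 / (γ - 1)))
    dsimp only
    linarith

lemma le_Fstar {γ k p : ℝ} (hγ : 1 < γ) (hk : 0 ≤ k) (hp : p ≤ 0) :
    p * (-p) ^ (1 / (γ - 1)) ≤ Fstar γ k p :=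
  le_csInf (nonempty_Ici.image _) (mem_lowerBounds_image_Fstar hγ hk hp)

lemma Fstar_nonpos {γ k p : ℝ} (hγ : 1 < γ) (hk : 0 ≤ k) (hp : p ≤ 0) : Fstar γ k p ≤ 0 :=
  csInf_le ⟨_, mem_lowerBounds_image_Fstar hγ hk hp⟩
    ⟨0, self_mem_Ici, by simp [Real.zero_rpow (zero_lt_one.trans hγ).ne']⟩

lemma Fstar_zero {γ k : ℝ} (hγ : 1 < γ) (hk : 0 ≤ k) : Fstar γ k 0 = 0 :=
  le_antisymm (Fstar_nonpos hγ hk le_rfl) (by simpa using le_Fstar hγ hk le_rfl)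

lemma hasDerivWithinAt_Fstar_zero {γ k : ℝ} (hγ : 1 < γ) (hk : 0 ≤ k) :
    HasDerivWithinAt (Fstar γ k) 0 (Iic 0) 0 := by
  have hg : 0 < 1 / (γ - 1) := one_div_pos.2 (sub_pos.2 hγ)
  rw [hasDerivWithinAt_iff_isLittleO, Asymptotics.isLittleO_iff]
  intro c hc
  have hlim : Tendsto (fun p : ℝ => (-p) ^ (1 / (γ - 1))) (𝓝 0) (𝓝 0) := by
    have : Continuous fun p : ℝ => (-p) ^ (1 / (γ - 1)) :=
      continuous_neg.rpow_const fun _ => Or.inr hg.le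
    simpa only [neg_zero, Real.zero_rpow hg.ne'] using this.tendsto 0
  filter_upwards [self_mem_nhdsWithin, nhdsWithin_le_nhds (hlim.eventually_le_const hc)]
    with p hp hpc
  have hp : p ≤ 0 := hp
  rw [Fstar_zero hγ hk, sub_zero, smul_zero, sub_zero, sub_zero, Real.norm_eq_abs,
    Real.norm_eq_abs, abs_of_nonpos (Fstar_nonpos hγ hk hp), abs_of_nonpos hp]
  have := le_Fstar hγ hk hp
  nlinarith [mul_le_mul_of_nonneg_left hpc (neg_nonneg.2 hp)]

section Gstar

variable {h : ℝ → ℝ} {abar : ℝ}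

lemma mem_Icc_of_monotoneOn (habar : 0 ≤ abar) (hmono : MonotoneOn h (Icc 0 abar)) (h0 : h 0 = 0)
    {a : ℝ} (ha : a ∈ Icc 0 abar) : h a ∈ Icc 0 (h abar) :=
  ⟨h0 ▸ hmono (left_mem_Icc.2 habar) ha ha.1, hmono ha (right_mem_Icc.2 habar) ha.2⟩

lemma bddAbove_image_Gstar (hcont : ContinuousOn h (Icc 0 abar)) (p : ℝ) :
    BddAbove ((fun a : ℝ => a + h a * p) '' Icc 0 abar) :=
  isCompact_Icc.bddAbove_image (continuousOn_id.add (hcont.mul continuousOn_const))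

lemma le_Gstar (hcont : ContinuousOn h (Icc 0 abar)) (p : ℝ) {a : ℝ} (ha : a ∈ Icc 0 abar) :
    a + h a * p ≤ Gstar h abar p :=
  le_csSup (bddAbove_image_Gstar hcont p) ⟨a, ha, rfl⟩

lemma Gstar_le (habar : 0 ≤ abar) {p M : ℝ} (hM : ∀ a ∈ Icc 0 abar, a + h a * p ≤ M) :
    Gstar h abar p ≤ M :=
  csSup_le ((nonempty_Icc.2 habar).image _) (forall_mem_image.2 hM)

lemma Gstar_zero (habar : 0 ≤ abar) (hcont : ContinuousOn h (Icc 0 abar)) :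
    Gstar h abar 0 = abar :=
  le_antisymm (Gstar_le habar fun a ha => by simpa using ha.2)
    (by simpa using le_Gstar hcont 0 (right_mem_Icc.2 habar))

lemma abs_Gstar_sub_le (habar : 0 ≤ abar) (hcont : ContinuousOn h (Icc 0 abar))
    (hmono : MonotoneOn h (Icc 0 abar)) (h0 : h 0 = 0) (p q : ℝ) :
    |Gstar h abar p - Gstar h abar q| ≤ h abar * |p - q| := by
  have key (p q : ℝ) : Gstar h abar p ≤ Gstar h abar q + h abar * |p - q| := by
    refine Gstar_le habar fun a ha => ?_
    obtain ⟨hnn, hle⟩ := mem_Icc_of_monotoneOn habar hmono h0 ha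
    have h1 := le_Gstar hcont q ha
    have h2 := mul_le_mul_of_nonneg_left (le_abs_self (p - q)) hnn
    have h3 := mul_le_mul_of_nonneg_right hle (abs_nonneg (p - q))
    linarith
  have h1 := key p q
  have h2 := key q p
  rw [abs_sub_comm q p] at h2
  exact abs_sub_le_iff.2 ⟨by linarith, by linarith⟩

lemma continuous_Gstar (habar : 0 ≤ abar) (hcont : ContinuousOn h (Icc 0 abar))
    (hmono : MonotoneOn h (Icc 0 abar)) (h0 : h 0 = 0) : Continuous (Gstar h abar) :=
  (LipschitzWith.of_dist_le' (K := h abar) fun p q => by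
    simpa only [Real.dist_eq] using abs_Gstar_sub_le habar hcont hmono h0 p q).continuous

lemma hasDerivWithinAt_Gstar_zero (habar : 0 ≤ abar) (hcont : ContinuousOn h (Icc 0 abar))
    (hmono : MonotoneOn h (Icc 0 abar)) (h0 : h 0 = 0) :
    HasDerivWithinAt (Gstar h abar) (h abar) (Iic 0) 0 := by
  have hR : abar ∈ Icc 0 abar := right_mem_Icc.2 habar
  rw [hasDerivWithinAt_iff_isLittleO, Asymptotics.isLittleO_iff]
  intro c hc
  obtain ⟨δ, hδ, hnear⟩ := Metric.continuousWithinAt_iff.1 (hcont abar hR) c hc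
  have hlim : Tendsto (fun p : ℝ => h abar * -p) (𝓝 0) (𝓝 0) := by
    have : Continuous fun p : ℝ => h abar * -p := by fun_prop
    simpa using this.tendsto 0
  filter_upwards [self_mem_nhdsWithin, nhdsWithin_le_nhds (hlim.eventually_le_const hδ)]
    with p hp hpδ
  have hp : 0 ≤ -p := neg_nonneg.2 hp
  have hlow := le_Gstar hcont p hR
  have hup : Gstar h abar p ≤ abar + (h abar - c) * p := by
    refine Gstar_le habar fun a ha => ?_
    have hha := mul_nonneg (mem_Icc_of_monotoneOn habar hmono h0 ha).1 hp
    have hcp := mul_nonneg hc.le hp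
    rcases lt_or_ge (abar - δ) a with haδ | haδ
    · have hd := hnear ha (by rw [Real.dist_eq, abs_lt]; constructor <;> linarith [ha.2])
      rw [Real.dist_eq, abs_lt] at hd
      nlinarith [mul_le_mul_of_nonneg_right hd.1.le hp, ha.2]
    · linarith
  rw [Gstar_zero habar hcont, sub_zero, smul_eq_mul, Real.norm_eq_abs, Real.norm_eq_abs,
    abs_of_nonpos (neg_nonneg.1 hp), abs_le]
  constructor <;> linarith

end Gstar

lemma HasDerivWithinAt.comp_mul_const_Iic {f : ℝ → ℝ} {f' c : ℝ}
    (hf : HasDerivWithinAt f f' (Iic 0) 0) (hc : 0 ≤ c) :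
    HasDerivWithinAt (fun x => f (x * c)) (f' * c) (Iic 0) 0 := by
  have hlin : HasDerivWithinAt (fun x : ℝ => x * c) c (Iic 0) 0 := by
    simpa using (hasDerivWithinAt_id (0 : ℝ) (Iic 0)).mul_const c
  exact HasDerivWithinAt.comp (0 : ℝ) (by simpa using hf) hlin
    fun x hx => mul_nonpos_of_nonpos_of_nonneg hx hc

lemma integral_mul_exp_neg_mul (ρ T : ℝ) :
    ∫ t in (0 : ℝ)..T, ρ * Real.exp (-ρ * t) = 1 - Real.exp (-ρ * T) := by
  have hderiv (t : ℝ) : HasDerivAt (fun t => -Real.exp (-ρ * t)) (ρ * Real.exp (-ρ * t)) t := by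
    have := (((hasDerivAt_id t).const_mul (-ρ)).exp).fun_neg
    refine this.congr_deriv ?_
    simp [mul_comm]
  rw [intervalIntegral.integral_eq_sub_of_hasDerivAt (fun t _ => hderiv t)
    ((by fun_prop : Continuous fun t => ρ * Real.exp (-ρ * t)).intervalIntegrable 0 T)]
  simp [neg_add_eq_sub]

lemma hasDerivWithinAt_integral_comp_mul {G w c : ℝ → ℝ} {G' K : ℝ} (T : ℝ)
    (hG : ∀ p q, |G p - G q| ≤ K * |p - q|) (hcontG : Continuous G)
    (hG' : HasDerivWithinAt G G' (Iic 0) 0) (hw : Continuous w) (hc : Continuous c)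
    (hc0 : ∀ t, 0 ≤ c t) :
    HasDerivWithinAt (fun x => ∫ t in (0 : ℝ)..T, w t * G (x * c t))
      (∫ t in (0 : ℝ)..T, w t * (G' * c t)) (Iic 0) 0 := by
  have hint (x : ℝ) : IntervalIntegrable (fun t => w t * G (x * c t)) MeasureTheory.volume 0 T :=
    (by fun_prop : Continuous fun t => w t * G (x * c t)).intervalIntegrable _ _
  have hslope (x : ℝ) : slope (fun x => ∫ t in (0 : ℝ)..T, w t * G (x * c t)) 0 x =
      ∫ t in (0 : ℝ)..T, w t * slope (fun x => G (x * c t)) 0 x := by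
    rw [slope_def_field, ← intervalIntegral.integral_sub (hint x) (hint 0),
      ← intervalIntegral.integral_div]
    congr 1 with t
    rw [slope_def_field]
    ring
  rw [hasDerivWithinAt_iff_tendsto_slope, funext hslope]
  refine intervalIntegral.tendsto_integral_filter_of_dominated_convergence
    (fun t => |w t| * (K * c t)) (Eventually.of_forall fun x => ?_) ?_ ?_ ?_
  · simp only [slope_def_field]
    exact (by fun_prop : Continuous fun t => w t * ((G (x * c t) - G (0 * c t)) / (x - 0))
      ).aestronglyMeasurable
  · filter_upwards [self_mem_nhdsWithin] with x hx
    refine Eventually.of_forall fun t _ => ?_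
    have hx0 : 0 < |x| := abs_pos.2 hx.2
    rw [slope_def_field, Real.norm_eq_abs, abs_mul, abs_div, sub_zero]
    refine mul_le_mul_of_nonneg_left ((div_le_iff₀ hx0).2 ((hG _ _).trans_eq ?_)) (abs_nonneg _)
    rw [zero_mul, sub_zero, abs_mul, abs_of_nonneg (hc0 t)]
    ring
  · exact (by fun_prop : Continuous fun t => |w t| * (K * c t)).intervalIntegrable _ _
  · refine Eventually.of_forall fun t _ => Tendsto.const_mul _ ?_
    exact hasDerivWithinAt_iff_tendsto_slope.1 (hG'.comp_mul_const_Iic (hc0 t))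

/-- `FG_N(0) = ā(1 − e^{−ρT})` and the left derivative of `FG_N` at `0`
exists and equals `h(ā)(1 − e^{−rT})`. -/
theorem statement6 (γ k ρ r T abar : ℝ) (h : ℝ → ℝ) (N : ℕ)
    (hγ : 1 < γ) (hk : 0 ≤ k) (hρ : 0 < ρ) (hr : 0 < r) (hT : 0 < T) (habar : 0 < abar)
    (hcont : ContinuousOn h (Set.Icc 0 abar))
    (hmono : MonotoneOn h (Set.Icc 0 abar)) (h0 : h 0 = 0) :
    FGN γ k ρ r T abar h N 0 = abar * (1 - Real.exp (-ρ * T)) ∧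
    Filter.Tendsto
      (fun lam : ℝ => (FGN γ k ρ r T abar h N lam - FGN γ k ρ r T abar h N 0) / lam)
      (nhdsWithin 0 (Set.Iio 0)) (nhds (h abar * (1 - Real.exp (-r * T)))) := by
  have hG0 := Gstar_zero habar.le hcont
  have hlip := abs_Gstar_sub_le habar.le hcont hmono h0
  have hGc := continuous_Gstar habar.le hcont hmono h0
  have hGd := hasDerivWithinAt_Gstar_zero habar.le hcont hmono h0
  constructor
  · simp only [FGN, zero_mul, mul_zero, Fstar_zero hγ hk, Fstar_zero hγ le_rfl, hG0]
    rw [intervalIntegral.integral_mul_const, integral_mul_exp_neg_mul]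
    ring
  have hE : 0 ≤ Real.exp ((ρ - r) * T) := (Real.exp_pos _).le
  have hFk := ((hasDerivWithinAt_Fstar_zero hγ hk).comp_mul_const_Iic hE).const_mul
    (-(N : ℝ) * Real.exp (-ρ * T))
  have hF0 := ((hasDerivWithinAt_Fstar_zero hγ le_rfl).comp_mul_const_Iic hE).const_mul
    (Real.exp (-ρ * T))
  have hI := hasDerivWithinAt_integral_comp_mul (w := fun t => ρ * Real.exp (-ρ * t))
    (c := fun t => r / ρ * Real.exp ((ρ - r) * t)) T hlip hGc hGd (by fun_prop) (by fun_prop)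
    fun t => by positivity
  have hval : ∫ t in (0 : ℝ)..T,
      ρ * Real.exp (-ρ * t) * (h abar * (r / ρ * Real.exp ((ρ - r) * t))) =
      h abar * (1 - Real.exp (-r * T)) := by
    rw [← integral_mul_exp_neg_mul r T, ← intervalIntegral.integral_const_mul]
    congr 1 with t
    rw [show -r * t = -ρ * t + (ρ - r) * t by ring, Real.exp_add]
    field_simp
  rw [hval] at hI
  have hmain : HasDerivWithinAt (FGN γ k ρ r T abar h N) (h abar * (1 - Real.exp (-r * T)))
      (Iic 0) 0 := by
    refine (((hFk.sub hF0).add hI).congr_deriv (by ring)).congr_of_eventuallyEq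
      (Eventually.of_forall fun x => ?_) ?_ <;>
    simp only [FGN, Pi.add_apply, Pi.sub_apply, mul_left_comm _ (r / ρ), mul_assoc]
  have hs := hasDerivWithinAt_iff_tendsto_slope.1 hmain
  rw [Iic_sdiff_right] at hs
  simpa only [slope_fun_def_field, sub_zero] using hs
end

section
/- Let γ > 1 and k > 0, and let F(y) := −y^γ on [0, ∞). For every n ∈ ℕ and every y ≥ 0, the n-fold iterate of the intervention operator satisfies (𝓜^n F)(y) = − ( (1+k)^{1/(γ−1)} / ( n + (1+k)^{1/(γ−1)} ) )^{γ−1} · y^γ. -/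
/-- The intervention operator `(𝓜V)(y) = sup_{0 ≤ η ≤ y} (V(y−η) − (1+k)·η^γ)`. -/
noncomputable def Mop (γ k : ℝ) (V : ℝ → ℝ) (y : ℝ) : ℝ :=
  sSup ((fun η : ℝ => V (y - η) - (1 + k) * η ^ γ) '' Set.Icc 0 y)

/-- Radon's inequality for two terms, one of which has weight `1`. -/
theorem add_rpow_div_le {γ b x z : ℝ} (hγ : 1 ≤ γ) (hb : 0 < b) (hx : 0 ≤ x) (hz : 0 ≤ z) :
    (x + z) ^ γ / (b + 1) ^ (γ - 1) ≤ x ^ γ / b ^ (γ - 1) + z ^ γ := by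
  have hb1 : 0 < b + 1 := by linarith
  have h := (convexOn_rpow hγ).2 (Set.mem_Ici.2 (div_nonneg hx hb.le)) (Set.mem_Ici.2 hz)
    (div_nonneg hb.le hb1.le) (one_div_nonneg.2 hb1.le)
    (by rw [← add_div, div_self hb1.ne'] : b / (b + 1) + 1 / (b + 1) = 1)
  have hmean : (b / (b + 1)) • (x / b) + (1 / (b + 1)) • z = (x + z) / (b + 1) := by
    simp only [smul_eq_mul]
    field_simp
  rw [hmean] at h
  simp only [smul_eq_mul] at h
  rw [Real.div_rpow (by positivity) hb1.le, Real.div_rpow hx hb.le] at h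
  rw [Real.rpow_sub_one hb1.ne', Real.rpow_sub_one hb.ne']
  calc (x + z) ^ γ / ((b + 1) ^ γ / (b + 1)) = (b + 1) * ((x + z) ^ γ / (b + 1) ^ γ) := by
        field_simp
    _ ≤ (b + 1) * (b / (b + 1) * (x ^ γ / b ^ γ) + 1 / (b + 1) * z ^ γ) := by gcongr
    _ = x ^ γ / (b ^ γ / b) + z ^ γ := by field_simp

/-- The equality case of `add_rpow_div_le`: both terms are proportional to their weights. -/
theorem rpow_div_add_rpow_eq {γ b y : ℝ} (hb : 0 < b) (hy : 0 ≤ y) :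
    (b * (y / (b + 1))) ^ γ / b ^ (γ - 1) + (y / (b + 1)) ^ γ = y ^ γ / (b + 1) ^ (γ - 1) := by
  have hb1 : 0 < b + 1 := by linarith
  rw [Real.mul_rpow hb.le (by positivity), Real.div_rpow hy hb1.le,
    Real.rpow_sub_one hb1.ne', Real.rpow_sub_one hb.ne']
  field_simp

/-- The intervention operator sends `x ↦ -(a / b)^(γ-1) x^γ` to `y ↦ -(a / (b + 1))^(γ-1) y^γ`
when `a^(γ-1) = 1 + k`. -/
theorem Mop_eq_of_eq_neg_mul_rpow {γ k a b y : ℝ} {V : ℝ → ℝ} (hγ : 1 ≤ γ) (ha : 0 ≤ a)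
    (hak : a ^ (γ - 1) = 1 + k) (hb : 0 < b) (hy : 0 ≤ y)
    (hV : ∀ x, 0 ≤ x → V x = -(a / b) ^ (γ - 1) * x ^ γ) :
    Mop γ k V y = -(a / (b + 1)) ^ (γ - 1) * y ^ γ := by
  have hb1 : 0 < b + 1 := by linarith
  have hk : 0 ≤ 1 + k := hak ▸ Real.rpow_nonneg ha _
  have hcost : ∀ η, η ≤ y → V (y - η) - (1 + k) * η ^ γ =
      -((1 + k) * ((y - η) ^ γ / b ^ (γ - 1) + η ^ γ)) := by
    intro η hη
    rw [hV _ (sub_nonneg.2 hη), Real.div_rpow ha hb.le, hak]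
    ring
  have hvalue : -(a / (b + 1)) ^ (γ - 1) * y ^ γ =
      -((1 + k) * (y ^ γ / (b + 1) ^ (γ - 1))) := by
    rw [Real.div_rpow ha hb1.le, hak]
    ring
  rw [hvalue]
  refine IsGreatest.csSup_eq ⟨⟨y / (b + 1), ⟨by positivity, ?_⟩, ?_⟩, ?_⟩
  · exact div_le_self hy (by linarith)
  · have hsub : y - y / (b + 1) = b * (y / (b + 1)) := by
      field_simp
      ring
    simp only
    rw [hcost _ (div_le_self hy (by linarith)), hsub, rpow_div_add_rpow_eq hb hy]
  · rintro _ ⟨η, ⟨hη, hηy⟩, rfl⟩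
    simp only
    rw [hcost η hηy]
    have h := add_rpow_div_le hγ hb (sub_nonneg.2 hηy) hη
    rw [sub_add_cancel] at h
    exact neg_le_neg (mul_le_mul_of_nonneg_left h hk)

/-- for `γ > 1`, `k > 0`, `F(y) = −y^γ`, every `n ∈ ℕ` and `y ≥ 0`,
`(𝓜^n F)(y) = −((1+k)^{1/(γ−1)} / (n + (1+k)^{1/(γ−1)}))^{γ−1}·y^γ`. -/
theorem statement10 (γ k : ℝ) (hγ : 1 < γ) (hk : 0 < k) (n : ℕ) (y : ℝ) (hy : 0 ≤ y) :
    (Mop γ k)^[n] (fun x : ℝ => -x ^ γ) y =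
      -((1 + k) ^ (1 / (γ - 1)) / ((n : ℝ) + (1 + k) ^ (1 / (γ - 1)))) ^ (γ - 1) * y ^ γ := by
  have hk1 : 0 < 1 + k := by linarith
  have ha : 0 < (1 + k) ^ (1 / (γ - 1)) := Real.rpow_pos_of_pos hk1 _
  have hak : ((1 + k) ^ (1 / (γ - 1))) ^ (γ - 1) = 1 + k := by
    rw [← Real.rpow_mul hk1.le, one_div_mul_cancel (by linarith), Real.rpow_one]
  induction n generalizing y with
  | zero => rw [Function.iterate_zero_apply, Nat.cast_zero, zero_add, div_self ha.ne', Real.one_rpow,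
      neg_one_mul]
  | succ n ih =>
    rw [Function.iterate_succ_apply',
      Mop_eq_of_eq_neg_mul_rpow hγ.le ha.le hak (by positivity) hy ih, Nat.cast_succ,
      add_right_comm]
end

section
/- Let γ > 1, k > 0, d ∈ ℝ, T > 0, and t ∈ [0, T]. For n ∈ ℕ define A_n(t) := ( (1+k)^{1/(γ−1)} / ( n·e^{d(t−T)/(γ−1)} + (1+k)^{1/(γ−1)} ) )^{γ−1}. Then for every n ∈ ℕ, applying the intervention operator 𝓜 to the function y ↦ −A_n(t)·e^{d(t−T)}·y^γ yields the function y ↦ −A_{n+1}(t)·e^{d(t−T)}·y^γ on [0, ∞). -/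
/-- The time-dependent coefficient
`A_n(t) = ((1+k)^{1/(γ−1)} / (n·e^{d(t−T)/(γ−1)} + (1+k)^{1/(γ−1)}))^{γ−1}`. -/
noncomputable def AcoefD (γ k d T : ℝ) (n : ℕ) (t : ℝ) : ℝ :=
  ((1 + k) ^ (1 / (γ - 1)) /
      ((n : ℝ) * Real.exp (d * (t - T) / (γ - 1)) + (1 + k) ^ (1 / (γ - 1)))) ^ (γ - 1)

lemma rpow_mul_rpow_eq_scaled {γ a w x : ℝ} (ha : 0 < a) (hw : 0 < w) (hx : 0 ≤ x) :
    a ^ (γ - 1) * x ^ γ = (a * w) ^ (γ - 1) * (w * (x / w) ^ γ) := by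
  have hw' : w ^ γ = w ^ (γ - 1) * w := by
    rw [← Real.rpow_add_one hw.ne', sub_add_cancel]
  have hpos : 0 < w ^ γ := Real.rpow_pos_of_pos hw γ
  rw [Real.mul_rpow ha.le hw.le, Real.div_rpow hx hw.le]
  field_simp
  rw [hw']
  ring

/-- The infimal convolution of two scaled `γ`-th powers, attained. -/
lemma isGreatest_neg_rpow_sub_rpow {γ a c y : ℝ} (hγ : 1 < γ) (ha : 0 < a) (hc : 0 < c)
    (hy : 0 ≤ y) :
    IsGreatest ((fun η : ℝ => -a ^ (γ - 1) * (y - η) ^ γ - c ^ (γ - 1) * η ^ γ) '' Set.Icc 0 y)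
      (-(a * c / (a + c)) ^ (γ - 1) * y ^ γ) := by
  have hac : 0 < a + c := add_pos ha hc
  set w := c / (a + c) with hw
  set v := a / (a + c) with hv
  have hw0 : 0 < w := div_pos hc hac
  have hv0 : 0 < v := div_pos ha hac
  have hwv : w + v = 1 := by rw [hw, hv]; field_simp; ring
  have haw : a * w = a * c / (a + c) := by rw [hw]; ring
  have hcv : c * v = a * c / (a + c) := by rw [hv]; ring
  have split : ∀ η ∈ Set.Icc 0 y, -a ^ (γ - 1) * (y - η) ^ γ - c ^ (γ - 1) * η ^ γ =
      -(a * c / (a + c)) ^ (γ - 1) * (w * ((y - η) / w) ^ γ + v * (η / v) ^ γ) := by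
    intro η hη
    have h₁ := rpow_mul_rpow_eq_scaled (γ := γ) ha hw0 (sub_nonneg.2 hη.2)
    have h₂ := rpow_mul_rpow_eq_scaled (γ := γ) hc hv0 hη.1
    rw [haw] at h₁
    rw [hcv] at h₂
    linear_combination -h₁ - h₂
  constructor
  · have hη : v * y ∈ Set.Icc 0 y := ⟨by positivity, by nlinarith⟩
    refine ⟨v * y, hη, ?_⟩
    have h₁ : (y - v * y) / w = y := by
      rw [div_eq_iff hw0.ne']
      linear_combination -y * hwv
    have h₂ : v * y / v = y := by field_simp
    simp only []
    rw [split _ hη, h₁, h₂, ← add_mul, hwv, one_mul]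
  · rintro _ ⟨η, hη, rfl⟩
    simp only []
    rw [split η hη]
    have hconv := (convexOn_rpow hγ.le).2 (Set.mem_Ici.2 (div_nonneg (sub_nonneg.2 hη.2) hw0.le))
      (Set.mem_Ici.2 (div_nonneg hη.1 hv0.le)) hw0.le hv0.le hwv
    simp only [smul_eq_mul] at hconv
    rw [mul_div_cancel₀ _ hw0.ne', mul_div_cancel₀ _ hv0.ne', sub_add_cancel] at hconv
    have hm : 0 ≤ (a * c / (a + c)) ^ (γ - 1) := by positivity
    nlinarith [mul_le_mul_of_nonneg_left hconv hm]

lemma AcoefD_mul_exp {γ k : ℝ} (hγ : 1 < γ) (hk : 0 < k) (d T t : ℝ) (n : ℕ) :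
    AcoefD γ k d T n t * Real.exp (d * (t - T)) =
      ((1 + k) ^ (1 / (γ - 1)) * Real.exp (d * (t - T) / (γ - 1)) /
        (n * Real.exp (d * (t - T) / (γ - 1)) + (1 + k) ^ (1 / (γ - 1)))) ^ (γ - 1) := by
  have hg : γ - 1 ≠ 0 := (sub_pos.2 hγ).ne'
  have hexp : Real.exp (d * (t - T)) = Real.exp (d * (t - T) / (γ - 1)) ^ (γ - 1) := by
    rw [← Real.exp_mul, div_mul_cancel₀ _ hg]
  rw [AcoefD, hexp, ← Real.mul_rpow (by positivity) (by positivity), div_mul_eq_mul_div]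

/-- applying `𝓜` to `y ↦ −A_n(t)·e^{d(t−T)}·y^γ` yields
`y ↦ −A_{n+1}(t)·e^{d(t−T)}·y^γ` on `[0, ∞)`. -/
theorem statement11 (γ k d T t : ℝ) (hγ : 1 < γ) (hk : 0 < k) (hT : 0 < T)
    (ht : t ∈ Set.Icc 0 T) (n : ℕ) :
    ∀ y : ℝ, 0 ≤ y →
      Mop γ k (fun x : ℝ => -AcoefD γ k d T n t * Real.exp (d * (t - T)) * x ^ γ) y =
        -AcoefD γ k d T (n + 1) t * Real.exp (d * (t - T)) * y ^ γ := by
  intro y hy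
  set c := (1 + k) ^ (1 / (γ - 1)) with hc
  set e := Real.exp (d * (t - T) / (γ - 1)) with he
  have hc0 : 0 < c := by positivity
  have he0 : 0 < e := Real.exp_pos _
  have hck : 1 + k = c ^ (γ - 1) := by
    rw [hc, ← Real.rpow_mul (by positivity), one_div_mul_cancel (sub_pos.2 hγ).ne', Real.rpow_one]
  have ha0 : 0 < c * e / (n * e + c) := by positivity
  have hstep : c * e / ((n + 1 : ℕ) * e + c) =
      c * e / (n * e + c) * c / (c * e / (n * e + c) + c) := by
    push_cast
    field_simp
    ring
  have hmax := (isGreatest_neg_rpow_sub_rpow hγ ha0 hc0 hy).csSup_eq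
  simp only [Mop, neg_mul, AcoefD_mul_exp hγ hk, ← hc, ← he] at hmax ⊢
  rw [hstep, hck]
  exact hmax
end

section
/- Let γ > 1, k ≥ 0, y > 0, and let W : [0, ∞) → ℝ be continuous and concave; write ∂⁺W(x) for the right derivative of W at x (which exists, with value in (−∞, +∞], by concavity). Then the function η ↦ W(y−η) − (1+k)·η^γ is strictly concave on [0, y] and attains its maximum over [0, y] at a unique point η*, and η* = min( y, inf{ η ∈ [0, y] : ∂⁺W(y−η) > −γ·(1+k)·η^{γ−1} } ). -/
/-- Right derivative of `W` at `x` as an extended real: for a concave function the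
secant slopes `(W(x+t) − W(x))/t` are nonincreasing in `t > 0`, so the right
derivative equals their supremum (possibly `+∞`). -/
noncomputable def rightDerivE (W : ℝ → ℝ) (x : ℝ) : EReal :=
  ⨆ t ∈ Set.Ioi (0 : ℝ), (((W (x + t) - W x) / t : ℝ) : EReal)

theorem Real.rpow_tangent_lt {γ a b : ℝ} (hγ : 1 < γ) (ha : 0 ≤ a) (hb : 0 ≤ b) (hab : a ≠ b) :
    b ^ γ + γ * b ^ (γ - 1) * (a - b) < a ^ γ := by
  rcases hb.eq_or_lt with rfl | hb
  · have ha' : 0 < a := lt_of_le_of_ne ha hab.symm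
    rw [Real.zero_rpow (by linarith), Real.zero_rpow (by linarith)]
    simpa using Real.rpow_pos_of_pos ha' γ
  · have h1 : 1 + γ * (a / b - 1) < (1 + (a / b - 1)) ^ γ := by
      apply one_add_mul_self_lt_rpow_one_add _ _ hγ
      · have : 0 ≤ a / b := by positivity
        linarith
      · rw [sub_ne_zero, Ne, div_eq_one_iff_eq hb.ne']
        exact hab
    rw [add_sub_cancel, Real.div_rpow ha hb.le, lt_div_iff₀ (Real.rpow_pos_of_pos hb γ)] at h1
    have h2 : b ^ γ = b ^ (γ - 1) * b := by
      rw [← Real.rpow_add_one hb.ne', sub_add_cancel]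
    calc b ^ γ + γ * b ^ (γ - 1) * (a - b)
        = (1 + γ * (a / b - 1)) * b ^ γ := by
          rw [h2]
          field_simp
      _ < a ^ γ := h1

theorem lt_rightDerivE_of_lt_slope {W : ℝ → ℝ} {x t m : ℝ} (ht : 0 < t)
    (h : m < (W (x + t) - W x) / t) : (m : EReal) < rightDerivE W x :=
  (EReal.coe_lt_coe_iff.2 h).trans_le
    (le_iSup₂ (f := fun t (_ : t ∈ Set.Ioi (0 : ℝ)) =>
      (((W (x + t) - W x) / t : ℝ) : EReal)) t ht)

theorem ConcaveOn.rightDerivE_le_slope {W : ℝ → ℝ} (hW : ConcaveOn ℝ (Set.Ici 0) W) {u x : ℝ}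
    (hu : 0 ≤ u) (hux : u < x) :
    rightDerivE W x ≤ (((W x - W u) / (x - u) : ℝ) : EReal) := by
  refine iSup₂_le fun t ht => EReal.coe_le_coe_iff.2 ?_
  have ht : 0 < t := ht
  have h := hW.slope_anti_adjacent (x := u) (y := x) (z := x + t) hu
    (Set.mem_Ici.2 (by linarith)) hux (by linarith)
  rwa [add_sub_cancel_left] at h

/-- for `γ > 1`, `k ≥ 0`, `y > 0` and `W` continuous and concave on
`[0, ∞)`, the map `η ↦ W(y−η) − (1+k)·η^γ` is strictly concave on `[0, y]`, attains
its maximum over `[0, y]` at a unique point `η*`, and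
`η* = min(y, inf{η ∈ [0, y] : ∂⁺W(y−η) > −γ(1+k)η^{γ−1}})`
(the `min` with `y` is encoded as `sInf (insert y …)`, which equals `y` when the set
is empty and `min y (sInf …)` otherwise). -/
theorem statement12 (γ k y : ℝ) (W : ℝ → ℝ) (hγ : 1 < γ) (hk : 0 ≤ k) (hy : 0 < y)
    (hWcont : ContinuousOn W (Set.Ici 0)) (hWconc : ConcaveOn ℝ (Set.Ici 0) W) :
    StrictConcaveOn ℝ (Set.Icc 0 y) (fun η : ℝ => W (y - η) - (1 + k) * η ^ γ) ∧
    (∃! ηs : ℝ, ηs ∈ Set.Icc 0 y ∧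
      IsMaxOn (fun η : ℝ => W (y - η) - (1 + k) * η ^ γ) (Set.Icc 0 y) ηs) ∧
    (∀ ηs : ℝ, ηs ∈ Set.Icc 0 y →
      IsMaxOn (fun η : ℝ => W (y - η) - (1 + k) * η ^ γ) (Set.Icc 0 y) ηs →
      ηs = sInf (insert y {η : ℝ | η ∈ Set.Icc 0 y ∧
        ((-(γ * (1 + k) * η ^ (γ - 1)) : ℝ) : EReal) < rightDerivE W (y - η)})) := by
  have hc : 0 < 1 + k := by linarith
  have hmaps : Set.MapsTo (fun η : ℝ => y - η) (Set.Icc 0 y) (Set.Ici 0) :=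
    fun η hη => sub_nonneg.2 hη.2
  have hconc : StrictConcaveOn ℝ (Set.Icc 0 y) (fun η : ℝ => W (y - η) - (1 + k) * η ^ γ) := by
    refine ⟨convex_Icc 0 y, fun a ha b hb hab p q hp hq hpq => ?_⟩
    have h1 := hWconc.2 (hmaps ha) (hmaps hb) hp.le hq.le hpq
    have h2 := (strictConvexOn_rpow hγ).2 (x := a) (y := b) ha.1 hb.1 hab hp hq hpq
    simp only [smul_eq_mul] at h1 h2 ⊢
    have h3 : p * (y - a) + q * (y - b) = y - (p * a + q * b) := by
      linear_combination y * hpq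
    rw [h3] at h1
    have h4 := mul_lt_mul_of_pos_left h2 hc
    linarith
  have hcont : ContinuousOn (fun η : ℝ => W (y - η) - (1 + k) * η ^ γ) (Set.Icc 0 y) := by
    refine (hWcont.comp (by fun_prop) hmaps).sub (Continuous.continuousOn ?_)
    exact continuous_const.mul (Real.continuous_rpow_const (by linarith))
  refine ⟨hconc, ?_, fun ηs hηs hmax => ?_⟩
  · obtain ⟨ηs, hηs, hmax⟩ := isCompact_Icc.exists_isMaxOn (Set.nonempty_Icc.2 hy.le) hcont
    exact ⟨ηs, ⟨hηs, hmax⟩, fun η hη => hconc.eq_of_isMaxOn hη.2 hmax hη.1 hηs⟩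
  have hval : ∀ η ∈ Set.Icc 0 y, (1 + k) * (ηs ^ γ - η ^ γ) ≤ W (y - ηs) - W (y - η) := by
    intro η hη
    have h : W (y - η) - (1 + k) * η ^ γ ≤ W (y - ηs) - (1 + k) * ηs ^ γ := hmax hη
    linarith
  have htangent : ∀ η ∈ Set.Icc 0 y, ηs ≠ η →
      (1 + k) * (γ * η ^ (γ - 1) * (ηs - η)) < W (y - ηs) - W (y - η) := by
    intro η hη hne
    have h := mul_lt_mul_of_pos_left (Real.rpow_tangent_lt hγ hηs.1 hη.1 hne) hc
    linarith [hval η hη]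
  have habove : ∀ η, ηs < η → η ≤ y →
      ((-(γ * (1 + k) * η ^ (γ - 1)) : ℝ) : EReal) < rightDerivE W (y - η) := by
    intro η hlt hle
    refine lt_rightDerivE_of_lt_slope (sub_pos.2 hlt) ?_
    rw [lt_div_iff₀ (sub_pos.2 hlt), show y - η + (η - ηs) = y - ηs by ring]
    linarith [htangent η ⟨hηs.1.trans hlt.le, hle⟩ hlt.ne]
  have hbelow : ∀ η, 0 ≤ η → η < ηs →
      rightDerivE W (y - η) ≤ ((-(γ * (1 + k) * η ^ (γ - 1)) : ℝ) : EReal) := by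
    intro η h0 hlt
    refine (hWconc.rightDerivE_le_slope (sub_nonneg.2 hηs.2) (sub_lt_sub_left hlt y)).trans
      (EReal.coe_le_coe_iff.2 ?_)
    rw [show y - η - (y - ηs) = ηs - η by ring, div_le_iff₀ (sub_pos.2 hlt)]
    linarith [htangent η ⟨h0, hlt.le.trans hηs.2⟩ hlt.ne']
  symm
  refine csInf_eq_of_forall_ge_of_forall_gt_exists_lt (Set.insert_nonempty _ _) ?_ ?_
  · rintro η (rfl | ⟨hη, hlt⟩)
    · exact hηs.2
    · by_contra! h
      exact (hbelow η hη.1 h).not_gt hlt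
  · intro w hw
    rcases hηs.2.eq_or_lt with rfl | hlt
    · exact ⟨ηs, Set.mem_insert _ _, hw⟩
    · obtain ⟨η, h1, h2⟩ := exists_between (lt_min hw hlt)
      have h3 : η ≤ y := h2.le.trans (min_le_right _ _)
      exact ⟨η, Or.inr ⟨⟨hηs.1.trans h1.le, h3⟩, habove η h1 h3⟩, h2.trans_le (min_le_left _ _)⟩
end

section
/- Let γ > 1, k ≥ 0, y > 0, and let W : [0, ∞) → ℝ be continuous and concave with right derivative at 0 nonnegative, i.e. liminf_{x → 0⁺} ( W(x) − W(0) ) / x ≥ 0. Let η* be the unique maximizer over [0, y] of η ↦ W(y−η) − (1+k)·η^γ. Then η* < y. -/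
/-- for `γ > 1`, `k ≥ 0`, `y > 0` and `W` continuous and concave on
`[0, ∞)` with nonnegative right derivative at `0`
(`liminf_{x → 0⁺} (W(x) − W(0))/x ≥ 0`, taken in the extended reals), any maximizer
`η*` over `[0, y]` of `η ↦ W(y−η) − (1+k)·η^γ` satisfies `η* < y` (no-firing). -/
theorem statement13 (γ k y : ℝ) (W : ℝ → ℝ) (hγ : 1 < γ) (hk : 0 ≤ k) (hy : 0 < y)
    (hWcont : ContinuousOn W (Set.Ici 0)) (hWconc : ConcaveOn ℝ (Set.Ici 0) W)
    (hW0 : (0 : EReal) ≤ Filter.liminf (fun x : ℝ => (((W x - W 0) / x : ℝ) : EReal))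
      (nhdsWithin 0 (Set.Ioi 0)))
    (ηs : ℝ) (hmem : ηs ∈ Set.Icc 0 y)
    (hmax : IsMaxOn (fun η : ℝ => W (y - η) - (1 + k) * η ^ γ) (Set.Icc 0 y) ηs) :
    ηs < y := by
  refine lt_of_le_of_ne hmem.2 fun h => ?_
  subst h
  have hc : 0 < (1 + k) * ηs ^ (γ - 1) := by positivity
  have hc' : ((-((1 + k) * ηs ^ (γ - 1)) : ℝ) : EReal) < 0 := by
    exact_mod_cast neg_lt_zero.mpr hc
  have hev := Filter.eventually_lt_of_lt_liminf (hc'.trans_le hW0)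
  obtain ⟨x, hx, hx0, hxy⟩ := (hev.and (Ioo_mem_nhdsGT hy)).exists
  have hx' : -((1 + k) * ηs ^ (γ - 1)) < (W x - W 0) / x := EReal.coe_lt_coe_iff.mp hx
  rw [lt_div_iff₀ hx0] at hx'
  have hle : W (ηs - (ηs - x)) - (1 + k) * (ηs - x) ^ γ ≤ W (ηs - ηs) - (1 + k) * ηs ^ γ :=
    hmax ⟨by linarith, by linarith⟩
  rw [sub_sub_cancel, sub_self] at hle
  have hsplit : ∀ z : ℝ, 0 < z → z ^ γ = z * z ^ (γ - 1) := fun z hz => by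
    rw [Real.rpow_sub_one hz.ne', mul_div_cancel₀ _ hz.ne']
  have hmono : (ηs - x) ^ (γ - 1) ≤ ηs ^ (γ - 1) :=
    Real.rpow_le_rpow (by linarith) (by linarith) (by linarith)
  have hpow : (ηs - x) ^ γ ≤ (ηs - x) * ηs ^ (γ - 1) := by
    rw [hsplit _ (by linarith)]
    exact mul_le_mul_of_nonneg_left hmono (by linarith)
  rw [hsplit ηs hy] at hle
  have := mul_le_mul_of_nonneg_left hpow (by linarith : 0 ≤ 1 + k)
  linarith
end

section
/- Let γ > 2, ρ > 0, r > 0, σ > 0, T > 0, ā > 0, k > 0, N ∈ ℕ, and let h : [0, ā] → [0, ∞) be three times continuously differentiable, increasing and strictly convex with h(0) = 0, h′ convex, h′(0) = β > 0 and h″(0) = α > 0. Set d := ρ − r·γ, and for n ∈ {0, …, N} define the constant A^n := ( (1+k)^{1/(γ−1)} / ( n + (1+k)^{1/(γ−1)} ) )^{γ−1}, and A^{(n,d)}(t) := A^n if d > 0, and A^{(n,d)}(t) := ( (1+k)^{1/(γ−1)} / ( n·e^{d(t−T)/(γ−1)} + (1+k)^{1/(γ−1)} ) )^{γ−1} if d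 ≤ 0. For z ∈ ℝ let Â(z) denote the set of maximizers of a ↦ z·a − h(a) over [0, ā]. Then there exist b > 0, c > 0, M > 0 such that for every n ∈ {0, …, N} the function φ_n(t, y) := −A^{(n,d)}(t)·e^{d(t−T)}·y^γ + M·e^{b(T−t)}·(1 − e^{−c y}) satisfies, for all (t, y) ∈ [0, T] × [0, ∞): (i) −∂_t φ_n(t,y) + ρ·φ_n(t,y) − r·y·∂_y φ_n(t,y) − sup{ r·h(a)·∂_y φ_n(t,y) + ρ·a + (1/2)·r²σ²z²·∂²_{yy} φ_n(t,y) : z ∈ ℝ, a ∈ Â(z) } ≥ 0; (ii) φ_n(t, 0) ≥ 0; (iii) φ_n(T, y) ≥ −A^n·y^γ. -/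
/-- `Â(z) = argmax_{a ∈ [0, ā]} (z·a − h(a))`, the agent's optimal effort responses. -/
def Ahat (h : ℝ → ℝ) (abar z : ℝ) : Set ℝ :=
  {a | a ∈ Set.Icc 0 abar ∧ ∀ a' ∈ Set.Icc 0 abar, z * a' - h a' ≤ z * a - h a}

/-- The coefficient `A^{(n,d)}(t)` (with `d = ρ − rγ`): the constant
`A^n = ((1+k)^{1/(γ−1)}/(n + (1+k)^{1/(γ−1)}))^{γ−1}` when `d > 0`, and the
time-dependent version when `d ≤ 0`. -/
noncomputable def Acoef (γ k ρ r T : ℝ) (n : ℕ) (t : ℝ) : ℝ :=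
  if 0 < ρ - r * γ then
    ((1 + k) ^ (1 / (γ - 1)) / ((n : ℝ) + (1 + k) ^ (1 / (γ - 1)))) ^ (γ - 1)
  else
    ((1 + k) ^ (1 / (γ - 1)) /
        ((n : ℝ) * Real.exp ((ρ - r * γ) * (t - T) / (γ - 1)) + (1 + k) ^ (1 / (γ - 1)))) ^
      (γ - 1)

/-- The candidate supersolution
`φ_n(t, y) = −A^{(n,d)}(t)·e^{d(t−T)}·y^γ + M·e^{b(T−t)}·(1 − e^{−cy})`. -/
noncomputable def phiSuper (γ k ρ r T b c M : ℝ) (n : ℕ) (t y : ℝ) : ℝ :=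
  -Acoef γ k ρ r T n t * Real.exp ((ρ - r * γ) * (t - T)) * y ^ γ
    + M * Real.exp (b * (T - t)) * (1 - Real.exp (-c * y))

open Real

/-- A convex function vanishing at `0` dominates its tangent line at `0`. -/
theorem ConvexOn.deriv_zero_mul_le {h : ℝ → ℝ} {abar a : ℝ}
    (hconv : ConvexOn ℝ (Set.Icc 0 abar) h) (h0 : h 0 = 0)
    (hd : DifferentiableAt ℝ h 0) (ha : a ∈ Set.Icc 0 abar) : deriv h 0 * a ≤ h a := by
  rcases ha.1.eq_or_lt with rfl | hpos
  · simp [h0]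
  · have hs := hconv.le_slope_of_hasDerivAt ⟨le_rfl, ha.1.trans ha.2⟩ ha hpos hd.hasDerivAt
    rw [slope_def_field, h0, sub_zero, sub_zero, le_div_iff₀ hpos] at hs
    exact hs

/-- A nonzero optimal effort requires a compensation rate of at least `h′(0)`. -/
theorem deriv_zero_le_of_mem_Ahat {h : ℝ → ℝ} {abar z a : ℝ}
    (hconv : ConvexOn ℝ (Set.Icc 0 abar) h) (h0 : h 0 = 0)
    (hd : DifferentiableAt ℝ h 0) (ha : a ∈ Ahat h abar z) (hpos : 0 < a) :
    deriv h 0 ≤ z := by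
  have h1 := hconv.deriv_zero_mul_le h0 hd ha.1
  have h2 := ha.2 0 ⟨le_rfl, ha.1.1.trans ha.1.2⟩
  rw [h0] at h2
  exact le_of_mul_le_mul_right (by linarith) hpos

section Acoef

variable {γ k : ℝ} (ρ r T : ℝ) (n : ℕ)

theorem Acoef_terminal :
    Acoef γ k ρ r T n T =
      ((1 + k) ^ (1 / (γ - 1)) / ((n : ℝ) + (1 + k) ^ (1 / (γ - 1)))) ^ (γ - 1) := by
  simp [Acoef]

theorem Acoef_nonneg (hk : 0 < k) (t : ℝ) : 0 ≤ Acoef γ k ρ r T n t := by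
  unfold Acoef
  split_ifs <;> positivity

theorem differentiable_Acoef (hk : 0 < k) :
    Differentiable ℝ (Acoef γ k ρ r T n) := by
  unfold Acoef
  split_ifs
  · exact differentiable_const _
  · intro t
    have hK : 0 < (1 + k) ^ (1 / (γ - 1)) := by positivity
    have hden : 0 < (n : ℝ) * exp ((ρ - r * γ) * (t - T) / (γ - 1)) +
        (1 + k) ^ (1 / (γ - 1)) := by positivity
    refine DifferentiableAt.rpow_const ?_ (Or.inl (div_pos hK hden).ne')
    exact (differentiableAt_const _).div (by fun_prop) hden.ne'

theorem monotone_Acoef (hγ : 1 < γ) (hk : 0 < k) :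
    Monotone (Acoef γ k ρ r T n) := by
  intro s t hst
  unfold Acoef
  split_ifs with hd
  · exact le_rfl
  · have hγ' : 0 < γ - 1 := sub_pos.2 hγ
    have hK : 0 < (1 + k) ^ (1 / (γ - 1)) := by positivity
    have hexp : (ρ - r * γ) * (t - T) / (γ - 1) ≤ (ρ - r * γ) * (s - T) / (γ - 1) :=
      div_le_div_of_nonneg_right
        (mul_le_mul_of_nonpos_left (by linarith) (not_lt.1 hd)) hγ'.le
    gcongr

end Acoef

/-- Above the threshold rate `β`, the risk term absorbs the effort-cost term once
`c` is large enough, and leaves a uniform negative margin. -/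
theorem effort_cost_sub_risk_le {r σ β c abar z H P₁ P₂ G : ℝ} (hr : 0 < r)
    (hβ : 0 < β) (hc : 0 ≤ c) (hcβ : 4 * abar ≤ r * σ ^ 2 * β * c) (hz : β ≤ z)
    (hH0 : 0 ≤ H) (hH : H ≤ z * abar) (hP₁ : 0 ≤ P₁) (hP₂ : 0 ≤ P₂) (hG : 0 ≤ G) :
    r * H * (-P₁ + c * G) + 1 / 2 * r ^ 2 * σ ^ 2 * z ^ 2 * (-P₂ - c ^ 2 * G) ≤
      -(1 / 4 * r ^ 2 * σ ^ 2 * β ^ 2 * c ^ 2 * G) := by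
  have hz0 : 0 < z := hβ.trans_le hz
  have hcost : r * H * (c * G) ≤ r * (z * abar) * (c * G) := by gcongr
  have habs : r * (z * abar) * c ≤ 1 / 4 * r ^ 2 * σ ^ 2 * z ^ 2 * c ^ 2 := by
    have h1 : 4 * abar ≤ r * σ ^ 2 * z * c := hcβ.trans (by gcongr)
    have h2 := mul_le_mul_of_nonneg_left h1 (show 0 ≤ 1 / 4 * r * z * c by positivity)
    linarith only [h2]
  have hmargin : 1 / 4 * r ^ 2 * σ ^ 2 * β ^ 2 * c ^ 2 * G ≤
      1 / 4 * r ^ 2 * σ ^ 2 * z ^ 2 * c ^ 2 * G := by gcongr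
  have hP₁' : 0 ≤ r * H * P₁ := by positivity
  have hP₂' : 0 ≤ r ^ 2 * σ ^ 2 * z ^ 2 * P₂ := by positivity
  linarith only [hcost, mul_le_mul_of_nonneg_right habs hG, hmargin, hP₁', hP₂']

section phiSuper

variable {γ k ρ r T b c M : ℝ} {n : ℕ}

theorem hasDerivAt_phiSuper_time (hk : 0 < k) (t y : ℝ) :
    HasDerivAt (fun s => phiSuper γ k ρ r T b c M n s y)
      (-(deriv (Acoef γ k ρ r T n) t * exp ((ρ - r * γ) * (t - T)) * y ^ γ)
        - (ρ - r * γ) * (Acoef γ k ρ r T n t * exp ((ρ - r * γ) * (t - T)) * y ^ γ)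
        - b * (M * exp (b * (T - t)) * (1 - exp (-c * y)))) t := by
  have hA := (differentiable_Acoef (γ := γ) ρ r T n hk t).hasDerivAt
  have hE : HasDerivAt (fun s => exp ((ρ - r * γ) * (s - T)))
      (exp ((ρ - r * γ) * (t - T)) * ((ρ - r * γ) * 1)) t :=
    (((hasDerivAt_id t).sub_const T).const_mul _).exp
  have hF : HasDerivAt (fun s => exp (b * (T - s))) (exp (b * (T - t)) * (b * (-1))) t :=
    (((hasDerivAt_id t).const_sub T).const_mul _).exp
  unfold phiSuper
  refine (((hA.neg.mul hE).mul_const (y ^ γ)).add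
    ((hF.const_mul M).mul_const (1 - exp (-c * y)))).congr_deriv ?_
  simp only [Pi.neg_apply]
  ring

theorem hasDerivAt_exp_neg_mul (c y : ℝ) :
    HasDerivAt (fun x => exp (-c * x)) (-c * exp (-c * y)) y := by
  refine (((hasDerivAt_id y).const_mul (-c)).exp).congr_deriv ?_
  simp only [id_eq]
  ring

theorem deriv_phiSuper_space (hγ : 2 < γ) (t : ℝ) :
    deriv (fun x => phiSuper γ k ρ r T b c M n t x) = fun y =>
      -(Acoef γ k ρ r T n t * exp ((ρ - r * γ) * (t - T)) * (γ * y ^ (γ - 1)))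
        + M * exp (b * (T - t)) * (c * exp (-c * y)) := by
  ext y
  unfold phiSuper
  refine HasDerivAt.deriv ?_
  refine HasDerivAt.congr_deriv (((hasDerivAt_rpow_const (x := y) (p := γ) (Or.inr (by linarith))).const_mul
    (-Acoef γ k ρ r T n t * exp ((ρ - r * γ) * (t - T)))).add
    (((hasDerivAt_exp_neg_mul c y).const_sub 1).const_mul (M * exp (b * (T - t))))) ?_
  ring

theorem deriv_deriv_phiSuper_space (hγ : 2 < γ) (t y : ℝ) :
    deriv (deriv (fun x => phiSuper γ k ρ r T b c M n t x)) y =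
      -(Acoef γ k ρ r T n t * exp ((ρ - r * γ) * (t - T))
          * (γ * ((γ - 1) * y ^ (γ - 1 - 1))))
        - M * exp (b * (T - t)) * (c ^ 2 * exp (-c * y)) := by
  rw [deriv_phiSuper_space hγ]
  refine HasDerivAt.deriv ?_
  refine HasDerivAt.congr_deriv ((((hasDerivAt_rpow_const (x := y) (p := γ - 1) (Or.inr (by linarith))).const_mul
    γ).const_mul (Acoef γ k ρ r T n t * exp ((ρ - r * γ) * (t - T)))).neg.add
    (((hasDerivAt_exp_neg_mul c y).const_mul c).const_mul (M * exp (b * (T - t))))) ?_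
  ring

end phiSuper

/-- smooth supersolution construction, Lemma B.1: under the stated
assumptions on `γ`, the data and the cost function `h`, there exist `b, c, M > 0`
such that for every `n ≤ N`, the function `φ_n` is (i) a supersolution of the HJB
equation on `[0, T] × [0, ∞)`, (ii) nonnegative at `y = 0`, and (iii) dominates
`−A^n·y^γ` at the terminal time. -/
theorem statement16 (γ ρ r σ T abar k : ℝ) (N : ℕ) (h : ℝ → ℝ)
    (hγ : 2 < γ) (hρ : 0 < ρ) (hr : 0 < r) (hσ : 0 < σ) (hT : 0 < T)
    (habar : 0 < abar) (hk : 0 < k)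
    (hsmooth : ContDiffOn ℝ 3 h (Set.Icc 0 abar))
    (hmono : StrictMonoOn h (Set.Icc 0 abar))
    (hconv : StrictConvexOn ℝ (Set.Icc 0 abar) h)
    (hnonneg : ∀ a ∈ Set.Icc (0 : ℝ) abar, 0 ≤ h a)
    (h0 : h 0 = 0)
    (hderconv : ConvexOn ℝ (Set.Icc 0 abar) (deriv h))
    (hβ : 0 < deriv h 0) (hα : 0 < deriv (deriv h) 0) :
    ∃ b > (0 : ℝ), ∃ c > (0 : ℝ), ∃ M > (0 : ℝ),
      ∀ n ≤ N, ∀ t ∈ Set.Icc (0 : ℝ) T, ∀ y ∈ Set.Ici (0 : ℝ),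
        (0 ≤ -deriv (fun s : ℝ => phiSuper γ k ρ r T b c M n s y) t
            + ρ * phiSuper γ k ρ r T b c M n t y
            - r * y * deriv (fun x : ℝ => phiSuper γ k ρ r T b c M n t x) y
            - sSup {v : ℝ | ∃ z : ℝ, ∃ a ∈ Ahat h abar z,
                v = r * h a * deriv (fun x : ℝ => phiSuper γ k ρ r T b c M n t x) y
                    + ρ * a
                    + 1 / 2 * r ^ 2 * σ ^ 2 * z ^ 2 *
                        deriv (deriv (fun x : ℝ => phiSuper γ k ρ r T b c M n t x)) y}) ∧
        0 ≤ phiSuper γ k ρ r T b c M n t 0 ∧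
        -((1 + k) ^ (1 / (γ - 1)) / ((n : ℝ) + (1 + k) ^ (1 / (γ - 1)))) ^ (γ - 1) * y ^ γ
          ≤ phiSuper γ k ρ r T b c M n T y := by
  have hd : DifferentiableAt ℝ h 0 := differentiableAt_of_deriv_ne_zero hβ.ne'
  set β := deriv h 0
  set c := 4 * abar / (r * σ ^ 2 * β) with hc_def
  have hc : 0 < c := by positivity
  have hcβ : r * σ ^ 2 * β * c = 4 * abar := by rw [hc_def]; field_simp
  set q := 1 / 4 * r ^ 2 * σ ^ 2 * β ^ 2 * c ^ 2 with hq_def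
  set κ := min ρ q
  have hκ : 0 < κ := lt_min hρ (by positivity)
  refine ⟨r, hr, c, hc, ρ * abar / κ, by positivity, ?_⟩
  have hMκ : κ * (ρ * abar / κ) = ρ * abar := by field_simp
  have hM : 0 < ρ * abar / κ := by positivity
  generalize ρ * abar / κ = M at hMκ hM
  intro n _ t ht y hy
  rw [Set.mem_Ici] at hy
  refine ⟨?_, ?_, ?_⟩
  · have hA' : 0 ≤ deriv (Acoef γ k ρ r T n) t :=
      (monotone_Acoef ρ r T n (by linarith) hk).deriv_nonneg
    have hA : 0 ≤ Acoef γ k ρ r T n t := Acoef_nonneg ρ r T n hk t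
    have hyy : y ^ γ = y * y ^ (γ - 1) := by
      rw [mul_comm, ← rpow_add_one' hy (by linarith), sub_add_cancel]
    rw [(hasDerivAt_phiSuper_time hk t y).deriv, deriv_deriv_phiSuper_space hγ,
      deriv_phiSuper_space hγ]
    unfold phiSuper
    beta_reduce
    have hEM : M ≤ M * exp (r * (T - t)) :=
      le_mul_of_one_le_right hM.le
        (one_le_exp (mul_nonneg hr.le (sub_nonneg.2 ht.2)))
    set E := M * exp (r * (T - t))
    have hE : 0 < E := hM.trans_le hEM
    set A := Acoef γ k ρ r T n t
    set D := exp ((ρ - r * γ) * (t - T))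
    have hD : 0 < D := exp_pos _
    have hw : 0 < exp (-c * y) := exp_pos _
    have hw1 : exp (-c * y) ≤ 1 := exp_le_one_iff.2 (by nlinarith)
    have hcyw : c * y * exp (-c * y) ≤ 1 - exp (-c * y) := by
      have hmul : exp (c * y) * exp (-c * y) = 1 := by
        rw [← exp_add]; simp
      nlinarith [mul_le_mul_of_nonneg_right (add_one_le_exp (c * y)) hw.le]
    set w := exp (-c * y)
    have hdrift : ρ * E * (1 - w) ≤
        -(-(deriv (Acoef γ k ρ r T n) t * D * y ^ γ) - (ρ - r * γ) * (A * D * y ^ γ)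
            - r * (E * (1 - w)))
          + ρ * (-A * D * y ^ γ + E * (1 - w))
          - r * y * (-(A * D * (γ * y ^ (γ - 1))) + E * (c * w)) := by
      have h1 : 0 ≤ deriv (Acoef γ k ρ r T n) t * D * y ^ γ := by positivity
      have h2 : r * E * (c * y * w) ≤ r * E * (1 - w) := by gcongr
      rw [hyy] at h1 ⊢
      linarith
    refine sub_nonneg.2 (le_trans (Real.sSup_le ?_ ?_) hdrift)
    · rintro v ⟨z, a, ha, rfl⟩
      have hP1 : 0 ≤ A * D * (γ * y ^ (γ - 1)) := by positivity
      have hP2 : 0 ≤ A * D * (γ * ((γ - 1) * y ^ (γ - 1 - 1))) := by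
        have : 0 < γ - 1 := by linarith
        positivity
      generalize A * D * (γ * y ^ (γ - 1)) = P₁ at hP1
      generalize A * D * (γ * ((γ - 1) * y ^ (γ - 1 - 1))) = P₂ at hP2
      have hρE : 0 ≤ ρ * E * (1 - w) := by
        have : 0 ≤ 1 - w := sub_nonneg.2 hw1
        positivity
      have hS : 0 ≤ r ^ 2 * σ ^ 2 * z ^ 2 := by positivity
      rcases ha.1.1.eq_or_lt with rfl | hpos
      · rw [h0]
        have : 0 ≤ P₂ + E * (c ^ 2 * w) := by positivity
        linarith only [mul_nonneg hS this, hρE]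
      · have hz : β ≤ z := deriv_zero_le_of_mem_Ahat hconv.convexOn h0 hd ha hpos
        have hz0 : 0 < z := hβ.trans_le hz
        have hha : h a ≤ z * abar := by
          have h2 := ha.2 0 ⟨le_rfl, habar.le⟩
          rw [h0] at h2
          nlinarith [mul_le_mul_of_nonneg_left ha.1.2 hz0.le]
        have hEw : 0 < E * w := mul_pos hE hw
        have h1 := effort_cost_sub_risk_le hr hβ hc.le hcβ.ge hz (hnonneg a ha.1) hha hP1 hP2
          (σ := σ) hEw.le
        have h2 : κ * (E * w) ≤ q * (E * w) :=
          mul_le_mul_of_nonneg_right (min_le_right _ _) hEw.le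
        have h3 : κ * (E * (1 - w)) ≤ ρ * (E * (1 - w)) :=
          mul_le_mul_of_nonneg_right (min_le_left _ _)
            (mul_nonneg hE.le (sub_nonneg.2 hw1))
        have h4 : ρ * a ≤ ρ * abar := mul_le_mul_of_nonneg_left ha.1.2 hρ.le
        have h5 : κ * M ≤ κ * E := mul_le_mul_of_nonneg_left hEM hκ.le
        linarith only [h1, hq_def ▸ h2, h3, h4, h5, hMκ]
    · exact mul_nonneg (mul_nonneg hρ.le hE.le) (sub_nonneg.2 hw1)
  · simp [phiSuper, zero_rpow (by linarith : γ ≠ 0)]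
  · have hw1 : exp (-c * y) ≤ 1 := exp_le_one_iff.2 (by nlinarith)
    unfold phiSuper
    rw [Acoef_terminal]
    simp only [sub_self, mul_zero, exp_zero, mul_one]
    exact le_add_of_nonneg_right (mul_nonneg hM.le (sub_nonneg.2 hw1))
end

section
/- Let ā > 0, ρ > 0, r > 0, σ > 0, and let h : [0, ā] → ℝ be differentiable, strictly convex and increasing with h(0) = 0 and h′(0) = β > 0. For z ∈ ℝ let Â(z) denote the set of maximizers of a ↦ z·a − h(a) over [0, ā]. Then for every p ∈ ℝ and every q ≤ 0: sup{ r·h(a)·p + ρ·a + (1/2)·q·r²σ²·z² : z ∈ ℝ, a ∈ Â(z) } = max( sup{ r·h(a)·p + ρ·a + (1/2)·q·r²σ²·z² : z ≥ β, a ∈ Â(z) }, 0 ). -/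
/-- A convex function on `[0, ā]` vanishing at `0` lies above its right tangent at `0`. -/
lemma mul_le_of_convexOn_of_hasDerivWithinAt {abar β a : ℝ} {h : ℝ → ℝ}
    (hconv : ConvexOn ℝ (Set.Icc 0 abar) h) (h0 : h 0 = 0)
    (hβ : HasDerivWithinAt h β (Set.Ici 0) 0) (ha : a ∈ Set.Icc 0 abar) : β * a ≤ h a := by
  rcases ha.1.eq_or_lt with rfl | hpos
  · simp [h0]
  · have hslope := hconv.le_slope_of_hasDerivWithinAt_Ioi ⟨le_rfl, ha.1.trans ha.2⟩ ha hpos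
      (hβ.mono Set.Ioi_subset_Ici_self)
    rwa [slope_def_field, h0, sub_zero, sub_zero, le_div_iff₀ hpos] at hslope

lemma zero_mem_Ahat {abar β z : ℝ} {h : ℝ → ℝ} (habar : 0 ≤ abar)
    (h0 : h 0 = 0) (hle : ∀ a ∈ Set.Icc 0 abar, β * a ≤ h a) (hz : z ≤ β) :
    (0 : ℝ) ∈ Ahat h abar z := by
  refine ⟨⟨le_rfl, habar⟩, fun a ha => ?_⟩
  have := hle a ha
  have := mul_le_mul_of_nonneg_right hz ha.1
  rw [h0]
  linarith

lemma eq_zero_of_mem_Ahat {abar β z a : ℝ} {h : ℝ → ℝ}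
    (h0 : h 0 = 0) (hle : ∀ a ∈ Set.Icc 0 abar, β * a ≤ h a) (hz : z < β)
    (ha : a ∈ Ahat h abar z) : a = 0 := by
  by_contra hne
  have hpos : 0 < a := ha.1.1.lt_of_ne' hne
  have := hle a ha.1
  have := ha.2 0 ⟨le_rfl, ha.1.1.trans ha.1.2⟩
  rw [h0] at this
  nlinarith [mul_lt_mul_of_pos_right hz hpos]

/-- for `h` differentiable, strictly convex and increasing on `[0, ā]`
with `h(0) = 0` and `h′(0) = β > 0`, and for every `p ∈ ℝ` and `q ≤ 0`, the
Hamiltonian satisfies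
`sup{r h(a) p + ρ a + ½ q r²σ² z² : z ∈ ℝ, a ∈ Â(z)}
 = max(sup{r h(a) p + ρ a + ½ q r²σ² z² : z ≥ β, a ∈ Â(z)}, 0)`. -/
theorem statement17 (abar ρ r σ β : ℝ) (h : ℝ → ℝ)
    (habar : 0 < abar) (hρ : 0 < ρ) (hr : 0 < r) (hσ : 0 < σ)
    (hdiff : DifferentiableOn ℝ h (Set.Icc 0 abar))
    (hconv : StrictConvexOn ℝ (Set.Icc 0 abar) h)
    (hmono : StrictMonoOn h (Set.Icc 0 abar))
    (h0 : h 0 = 0) (hβpos : 0 < β) (hβ : HasDerivWithinAt h β (Set.Ici 0) 0) :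
    ∀ p : ℝ, ∀ q ≤ (0 : ℝ),
      sSup {v : ℝ | ∃ z : ℝ, ∃ a ∈ Ahat h abar z,
          v = r * h a * p + ρ * a + 1 / 2 * q * r ^ 2 * σ ^ 2 * z ^ 2} =
        max (sSup {v : ℝ | ∃ z : ℝ, β ≤ z ∧ ∃ a ∈ Ahat h abar z,
          v = r * h a * p + ρ * a + 1 / 2 * q * r ^ 2 * σ ^ 2 * z ^ 2}) 0 := by
  intro p q hq
  have hle : ∀ a ∈ Set.Icc 0 abar, β * a ≤ h a := fun a ha =>
    mul_le_of_convexOn_of_hasDerivWithinAt hconv.convexOn h0 hβ ha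
  have hquad : ∀ z : ℝ, 1 / 2 * q * r ^ 2 * σ ^ 2 * z ^ 2 ≤ 0 := fun z => by
    have := mul_nonpos_of_nonpos_of_nonneg hq (by positivity : 0 ≤ r ^ 2 * σ ^ 2 * z ^ 2)
    linarith
  have hmem : ∀ z ≤ β, (0 : ℝ) ∈ Ahat h abar z := fun z hz =>
    zero_mem_Ahat habar.le h0 hle hz
  have hbdd : BddAbove {v : ℝ | ∃ z : ℝ, ∃ a ∈ Ahat h abar z,
      v = r * h a * p + ρ * a + 1 / 2 * q * r ^ 2 * σ ^ 2 * z ^ 2} := by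
    refine ⟨r * h abar * |p| + ρ * abar, ?_⟩
    rintro v ⟨z, a, ha, rfl⟩
    have hnn : 0 ≤ h a := (mul_nonneg hβpos.le ha.1.1).trans (hle a ha.1)
    have hha : h a ≤ h abar := hmono.monotoneOn ha.1 ⟨habar.le, le_rfl⟩ ha.1.2
    have hp : r * h a * p ≤ r * h abar * |p| :=
      (mul_le_mul_of_nonneg_left (le_abs_self p) (by positivity)).trans (by gcongr)
    have hρa : ρ * a ≤ ρ * abar := mul_le_mul_of_nonneg_left ha.1.2 hρ.le
    linarith [hquad z]
  have hsub : {v : ℝ | ∃ z : ℝ, β ≤ z ∧ ∃ a ∈ Ahat h abar z,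
      v = r * h a * p + ρ * a + 1 / 2 * q * r ^ 2 * σ ^ 2 * z ^ 2} ⊆
      {v : ℝ | ∃ z : ℝ, ∃ a ∈ Ahat h abar z,
      v = r * h a * p + ρ * a + 1 / 2 * q * r ^ 2 * σ ^ 2 * z ^ 2} := by
    rintro v ⟨z, -, hv⟩
    exact ⟨z, hv⟩
  apply le_antisymm
  · refine csSup_le ⟨_, 0, 0, hmem 0 hβpos.le, rfl⟩ ?_
    rintro v ⟨z, a, ha, rfl⟩
    rcases le_or_gt β z with hz | hz
    · exact le_max_of_le_left (le_csSup (hbdd.mono hsub) ⟨z, hz, a, ha, rfl⟩)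
    · rw [eq_zero_of_mem_Ahat h0 hle hz ha, h0]
      exact le_max_of_le_right (by simpa using hquad z)
  · refine max_le (csSup_le_csSup hbdd ⟨_, β, le_rfl, 0, hmem β le_rfl, rfl⟩ hsub) ?_
    exact le_csSup hbdd ⟨0, 0, hmem 0 hβpos.le, by simp [h0]⟩
end
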